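/- Let E be a centrally orthocomplete pseudo-effect algebra. Then: (1) for every family (cᵢ)_{i∈I} of pairwise disjoint central elements of E, the supremum c := ⋁_{i∈I} cᵢ is a central element of E, and the center Γ(E) is a complete Boolean algebra; (2) for every e ∈ E there is a smallest central element d ∈ Γ(E) with e ≤ d. -/

import Mathlib

namespace PEApaper

/-- The bare data of a partial-addition structure: a partial binary operation
(encoded via `Option`) together with constants `0` and `1`. -/
structure PartialStruct (E : Type) where
  padd : E → E → Option E
  zero : E
  one : E

namespace PartialStruct

variable {E : Type}

/-- `a ≤ b` iff `a + c = b` for some `c`. -/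
def le (P : PartialStruct E) (a b : E) : Prop := ∃ c, P.padd a c = some b

/-- `m` is the greatest lower bound (meet `a ∧ b`) of `a` and `b`. -/
def IsMeet (P : PartialStruct E) (a b m : E) : Prop :=
  P.le m a ∧ P.le m b ∧ ∀ x, P.le x a → P.le x b → P.le x m

/-- `j` is the least upper bound (join `a ∨ b`) of `a` and `b`. -/
def IsJoin (P : PartialStruct E) (a b j : E) : Prop :=
  P.le a j ∧ P.le b j ∧ ∀ x, P.le a x → P.le b x → P.le j x

/-- `s` is the supremum of the set `S`. -/
def IsSup (P : PartialStruct E) (S : Set E) (s : E) : Prop :=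
  (∀ x ∈ S, P.le x s) ∧ ∀ u, (∀ x ∈ S, P.le x u) → P.le s u

/-- Left-associated partial sum of a list, continuing from `acc`. -/
def IsSumFrom (P : PartialStruct E) : E → List E → E → Prop
  | acc, [], s => s = acc
  | acc, a :: l, s => ∃ t, P.padd acc a = some t ∧ IsSumFrom P t l s

/-- `s` is the (left-associated) orthosum `e₁ + e₂ + ⋯ + eₙ` of the list. -/
def IsSumList (P : PartialStruct E) (l : List E) (s : E) : Prop :=
  match l with
  | [] => s = P.zero
  | a :: t => IsSumFrom P a t s

/-- `c` is a central element: there is a PEA-isomorphism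
`f : E → E[0,c] × E[0,c∼]` with `f c = (c,0)` such that `f x = (x₁,x₂)`
implies `x = x₁ + x₂`.  The isomorphism onto the product of the two
interval pseudo-effect algebras is spelled out explicitly. -/
def IsCentral (P : PartialStruct E) (c : E) : Prop :=
  ∃ cs, P.padd c cs = some P.one ∧
    ∃ f : E → E × E,
      (∀ x, P.le (f x).1 c ∧ P.le (f x).2 cs) ∧
      Function.Injective f ∧
      (∀ y : E × E, P.le y.1 c → P.le y.2 cs → ∃ x, f x = y) ∧
      f c = (c, P.zero) ∧
      f P.one = (c, cs) ∧
      (∀ x, P.padd (f x).1 (f x).2 = some x) ∧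
      (∀ a b ab, P.padd a b = some ab →
        P.padd (f a).1 (f b).1 = some (f ab).1 ∧
        P.padd (f a).2 (f b).2 = some (f ab).2) ∧
      (∀ a b s t, P.padd (f a).1 (f b).1 = some s → P.le s c →
        P.padd (f a).2 (f b).2 = some t → P.le t cs →
        ∃ ab, P.padd a b = some ab)

/-- The center `Γ(E)`. -/
def center (P : PartialStruct E) : Set E := {c | P.IsCentral c}

/-- The central interval `Γ(E)[0,c] = Γ(E) ∩ E[0,c]`. -/
def centerIntervalSet (P : PartialStruct E) (c : E) : Set E :=
  {x | P.IsCentral x ∧ P.le x c}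

/-- A Γ-orthogonal family: one dominated elementwise by a pairwise
disjoint family of central elements. -/
def GammaOrthogonal (P : PartialStruct E) {I : Type} (e : I → E) : Prop :=
  ∃ c : I → E, (∀ i, P.IsCentral (c i)) ∧
    (∀ i j, i ≠ j → P.IsMeet (c i) (c j) P.zero) ∧
    ∀ i, P.le (e i) (c i)

/-- Centrally orthocomplete: every Γ-orthogonal family has a supremum. -/
def IsCOPEA (P : PartialStruct E) : Prop :=
  ∀ (I : Type) (e : I → E), P.GammaOrthogonal e → ∃ s, P.IsSup (Set.range e) s

/-- `c` is the central cover of `e`: the smallest central element above `e`. -/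
def IsCentralCover (P : PartialStruct E) (c e : E) : Prop :=
  P.IsCentral c ∧ P.le e c ∧ ∀ d, P.IsCentral d → P.le e d → P.le c d

/-- `[Q]`: the set of all suprema of Γ-orthogonal families of elements of `Q`. -/
def bra (P : PartialStruct E) (Q : Set E) : Set E :=
  {s | ∃ (I : Type) (e : I → E), (∀ i, e i ∈ Q) ∧ P.GammaOrthogonal e ∧
    P.IsSup (Set.range e) s}

/-- `Q^γ = {q ∧ c : q ∈ Q, c ∈ Γ(E)}`. -/
def gammaClosure (P : PartialStruct E) (Q : Set E) : Set E :=
  {m | ∃ q ∈ Q, ∃ c, P.IsCentral c ∧ P.IsMeet q c m}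

/-- `Q↓ = ⋃_{q ∈ Q} E[0,q]`. -/
def downSet (P : PartialStruct E) (Q : Set E) : Set E :=
  {e | ∃ q ∈ Q, P.le e q}

/-- `Q' = {e ∈ E : q ∧ e = 0 for all q ∈ Q}`. -/
def commutant (P : PartialStruct E) (Q : Set E) : Set E :=
  {e | ∀ q ∈ Q, P.IsMeet q e P.zero}

/-- A type-determining (TD) set: `K = [K] = K^γ`. -/
def IsTD (P : PartialStruct E) (K : Set E) : Prop :=
  P.bra K = K ∧ P.gammaClosure K = K

/-- A strongly type-determining (STD) set: `K = [K] = K↓`. -/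
def IsSTD (P : PartialStruct E) (K : Set E) : Prop :=
  P.bra K = K ∧ P.downSet K = K

/-- `c` is the type-cover of `K` (w.r.t. the central cover map `γ`):
the unique central element with `γK = Γ(E)[0,c]`. -/
def IsTypeCover (P : PartialStruct E) (γ : E → E) (K : Set E) (c : E) : Prop :=
  P.IsCentral c ∧ γ '' K = P.centerIntervalSet c

/-- An atom: a nonzero element with no proper nonzero subelement. -/
def IsAtom' (P : PartialStruct E) (a : E) : Prop :=
  a ≠ P.zero ∧ ∀ x, P.le x a → x = P.zero ∨ x = a

end PartialStruct

/-- A PEA-isomorphism between two partial-addition structures: a bijective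
morphism whose inverse is a morphism. -/
structure IsPEAIso {A B : Type} (P : PartialStruct A) (Q : PartialStruct B)
    (f : A → B) : Prop where
  bijective : Function.Bijective f
  map_one : f P.one = Q.one
  map_add : ∀ a b ab, P.padd a b = some ab → Q.padd (f a) (f b) = some (f ab)
  rev_add : ∀ a b s, Q.padd (f a) (f b) = some s → ∃ ab, P.padd a b = some ab

open scoped Classical in
/-- The (coordinatewise) product of a family of partial structures. -/
noncomputable def prodStruct {I : Type} {A : I → Type}
    (Ps : ∀ i, PartialStruct (A i)) : PartialStruct (∀ i, A i) where
  padd a b :=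
    if h : ∀ i, ∃ s, (Ps i).padd (a i) (b i) = some s
    then some fun i => Classical.choose (h i)
    else none
  zero := fun i => (Ps i).zero
  one := fun i => (Ps i).one

/-- A pseudo-effect algebra. -/
structure PEA (E : Type) extends PartialStruct E where
  assoc_def : ∀ a b c : E,
    (∃ ab, padd a b = some ab ∧ ∃ x, padd ab c = some x) ↔
    (∃ bc, padd b c = some bc ∧ ∃ y, padd a bc = some y)
  assoc_eq : ∀ a b c ab bc x y, padd a b = some ab → padd ab c = some x →
    padd b c = some bc → padd a bc = some y → x = y
  exu_right : ∀ a : E, ∃! d, padd a d = some one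
  exu_left : ∀ a : E, ∃! e, padd e a = some one
  shift : ∀ a b ab, padd a b = some ab →
    (∃ d, padd d a = some ab) ∧ (∃ e, padd b e = some ab)
  one_add : ∀ a x, padd one a = some x → a = zero
  add_one : ∀ a x, padd a one = some x → a = zero

namespace PEA

variable {E : Type} (P : PEA E)

/-- Shorthand for the underlying partial structure. -/
abbrev ps : PartialStruct E := P.toPartialStruct

theorem one_add_zero : P.padd P.one P.zero = some P.one := by
  obtain ⟨d, hd, -⟩ := P.exu_right P.one
  have h := P.one_add d P.one hd
  rwa [h] at hd

theorem zero_add_one : P.padd P.zero P.one = some P.one := by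
  obtain ⟨e, he, -⟩ := P.exu_left P.one
  have h := P.add_one e P.one he
  rwa [h] at he

theorem padd_zero (a : E) : P.padd a P.zero = some a := by
  obtain ⟨e, he, -⟩ := P.exu_left a
  have h1 : ∃ ab, P.padd e a = some ab ∧ ∃ x, P.padd ab P.zero = some x :=
    ⟨P.one, he, P.one, P.one_add_zero⟩
  obtain ⟨t, ht, y, hy⟩ := (P.assoc_def e a P.zero).mp h1
  have hxy : P.one = y :=
    P.assoc_eq e a P.zero P.one t P.one y he P.one_add_zero ht hy
  obtain ⟨d, hd, hu⟩ := P.exu_right e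
  have hta : t = a := by
    have h2 : t = d := hu t (by rw [← hxy] at hy; exact hy)
    have h3 : a = d := hu a he
    rw [h2, h3]
  rwa [hta] at ht

theorem zero_padd (a : E) : P.padd P.zero a = some a := by
  obtain ⟨d, hd, -⟩ := P.exu_right a
  have h1 : ∃ bc, P.padd a d = some bc ∧ ∃ y, P.padd P.zero bc = some y :=
    ⟨P.one, hd, P.one, P.zero_add_one⟩
  obtain ⟨t, ht, y, hy⟩ := (P.assoc_def P.zero a d).mpr h1
  have hxy : y = P.one :=
    P.assoc_eq P.zero a d t P.one y P.one ht hy hd P.zero_add_one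
  obtain ⟨e, he, hu⟩ := P.exu_left d
  have hta : t = a := by
    have h2 : t = e := hu t (by rw [hxy] at hy; exact hy)
    have h3 : a = e := hu a hd
    rw [h2, h3]
  rwa [hta] at ht

theorem zero_le (a : E) : P.ps.le P.zero a := ⟨a, P.zero_padd a⟩

theorem le_refl (a : E) : P.ps.le a a := ⟨P.zero, P.padd_zero a⟩

open scoped Classical in
/-- The interval pseudo-effect algebra `E[0,p]` as a partial structure on
the subtype `{x // x ≤ p}`; the sum is defined iff it is defined in `E`
and lies below `p`, and the unit is `p`. -/
noncomputable def intervalStruct (p : E) :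
    PartialStruct {x : E // P.ps.le x p} where
  padd a b := (P.padd a.1 b.1).bind fun s =>
    if h : P.ps.le s p then some ⟨s, h⟩ else none
  zero := ⟨P.zero, P.zero_le p⟩
  one := ⟨p, P.le_refl p⟩

end PEA

/-- The order relation of a complete Boolean algebra structure, made explicit. -/
def cbaLe {X : Type} (inst : CompleteBooleanAlgebra X) (a b : X) : Prop :=
  @LE.le X (by letI := inst; exact inferInstance) a b

end PEApaper

namespace PEApaper

/-- A complete lattice with an involutive map `c` such that `x ≤ c y` iff `x` and `y` are disjoint
is a complete Boolean algebra. -/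
noncomputable abbrev completeBooleanAlgebraOfPseudocomplement {X : Type*} [CompleteLattice X]
    (c : X → X) (hc : ∀ x y, x ≤ c y ↔ Disjoint x y) (hcc : ∀ x, c (c x) = x) :
    CompleteBooleanAlgebra X :=
  have himp : ∀ x y z, x ≤ c (y ⊓ c z) ↔ x ⊓ y ≤ z := fun x y z => by
    rw [hc, ← hcc z, hc, hcc, disjoint_iff, disjoint_iff, inf_assoc]
  have distrib : ∀ x y z : X, x ⊓ (y ⊔ z) ≤ x ⊓ y ⊔ x ⊓ z := fun x y z => by
    rw [inf_comm, ← himp]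
    exact sup_le ((himp _ _ _).2 (inf_comm y x ▸ le_sup_left))
      ((himp _ _ _).2 (inf_comm z x ▸ le_sup_right))
  { ‹CompleteLattice X›, DistribLattice.ofInfSupLe distrib with
    compl := c
    inf_compl_le_bot := fun x => ((hc _ _).1 le_rfl).symm.le_bot
    top_le_sup_compl := fun x => by
      have h : c (x ⊔ c x) ≤ ⊥ := by
        have h := (hc _ _).1 (le_refl (c (x ⊔ c x)))
        have h₁ : c (x ⊔ c x) ≤ c (c x) := (hc _ _).2 (h.mono_right le_sup_right)
        rw [hcc] at h₁
        exact h le_rfl (h₁.trans le_sup_left)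
      rw [← hcc (x ⊔ c x), hc]
      exact disjoint_bot_right.mono_right h
    le_top := fun _ => le_top
    bot_le := fun _ => bot_le }

namespace PEA

variable {E : Type} {P : PEA E} {a b c x y u w : E}

theorem exists_add_assoc (h₁ : P.padd a b = some x) (h₂ : P.padd x c = some y) :
    ∃ z, P.padd b c = some z ∧ P.padd a z = some y := by
  obtain ⟨z, hz, y', hy'⟩ := (P.assoc_def a b c).1 ⟨x, h₁, y, h₂⟩
  exact ⟨z, hz, by rw [P.assoc_eq a b c x z y y' h₁ h₂ hz hy', hy']⟩

theorem exists_assoc_add (h₁ : P.padd b c = some x) (h₂ : P.padd a x = some y) :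
    ∃ z, P.padd a b = some z ∧ P.padd z c = some y := by
  obtain ⟨z, hz, y', hy'⟩ := (P.assoc_def a b c).2 ⟨x, h₁, y, h₂⟩
  exact ⟨z, hz, by rw [hy', P.assoc_eq a b c z x y' y hz hy' h₁ h₂]⟩

theorem add_left_cancel (h₁ : P.padd a b = some x) (h₂ : P.padd a c = some x) : b = c := by
  obtain ⟨d, hd, -⟩ := P.exu_left x
  obtain ⟨e, he, hb⟩ := exists_assoc_add h₁ hd
  obtain ⟨e', he', hc⟩ := exists_assoc_add h₂ hd
  obtain rfl : e = e' := Option.some.inj (he.symm.trans he')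
  exact (P.exu_right e).unique hb hc

theorem add_right_cancel (h₁ : P.padd a c = some x) (h₂ : P.padd b c = some x) : a = b := by
  obtain ⟨d, hd, -⟩ := P.exu_right x
  obtain ⟨e, he, ha⟩ := exists_add_assoc h₁ hd
  obtain ⟨e', he', hb⟩ := exists_add_assoc h₂ hd
  obtain rfl : e = e' := Option.some.inj (he.symm.trans he')
  exact (P.exu_left e).unique ha hb

theorem eq_zero_of_add_eq_left (h : P.padd a b = some a) : b = P.zero :=
  add_left_cancel h (P.padd_zero a)

theorem eq_zero_of_add_eq_right (h : P.padd a b = some b) : a = P.zero :=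
  add_right_cancel h (P.zero_padd b)

theorem right_eq_zero (h : P.padd a b = some P.zero) : b = P.zero := by
  obtain ⟨z, hz, -⟩ := exists_add_assoc h P.zero_add_one
  exact P.add_one b z hz

theorem le_of_add (h : P.padd a b = some x) : P.ps.le a x := ⟨b, h⟩

theorem le_of_add' (h : P.padd a b = some x) : P.ps.le b x := (P.shift a b x h).2

theorem exists_add_of_le (h : P.ps.le a x) : ∃ b, P.padd b a = some x := by
  obtain ⟨b, hb⟩ := h
  exact (P.shift a b x hb).1

theorem le_trans (h₁ : P.ps.le a b) (h₂ : P.ps.le b c) : P.ps.le a c := by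
  obtain ⟨d, hd⟩ := h₁
  obtain ⟨e, he⟩ := h₂
  obtain ⟨z, -, hz⟩ := exists_add_assoc hd he
  exact ⟨z, hz⟩

theorem le_zero (h : P.ps.le a P.zero) : a = P.zero := by
  obtain ⟨b, hb⟩ := h
  have := right_eq_zero hb
  subst this
  exact Option.some.inj ((P.padd_zero a).symm.trans hb)

theorem le_antisymm (h₁ : P.ps.le a b) (h₂ : P.ps.le b a) : a = b := by
  obtain ⟨d, hd⟩ := h₁
  obtain ⟨e, he⟩ := h₂
  obtain ⟨z, hz, hz'⟩ := exists_add_assoc hd he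
  obtain rfl := eq_zero_of_add_eq_left hz'
  obtain rfl := right_eq_zero hz
  exact Option.some.inj (he.symm.trans (P.padd_zero b))

theorem le_one (a : E) : P.ps.le a P.one := by
  obtain ⟨d, hd, -⟩ := P.exu_right a
  exact ⟨d, hd⟩

theorem exists_add_le_left (h : P.padd a b = some x) (hb : P.ps.le c b) :
    ∃ y, P.padd a c = some y ∧ P.ps.le y x := by
  obtain ⟨d, hd⟩ := hb
  obtain ⟨y, hy, hy'⟩ := exists_assoc_add hd h
  exact ⟨y, hy, d, hy'⟩

theorem exists_add_le_right (h : P.padd a b = some x) (ha : P.ps.le c a) :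
    ∃ y, P.padd c b = some y ∧ P.ps.le y x := by
  obtain ⟨d, hd⟩ := exists_add_of_le ha
  obtain ⟨y, hy, hy'⟩ := exists_add_assoc hd h
  exact ⟨y, hy, le_of_add' hy'⟩

theorem exists_add_le (h : P.padd a b = some x) (ha : P.ps.le u a) (hb : P.ps.le w b) :
    ∃ y, P.padd u w = some y ∧ P.ps.le y x := by
  obtain ⟨y, hy, hyx⟩ := exists_add_le_right h ha
  obtain ⟨z, hz, hzy⟩ := exists_add_le_left hy hb
  exact ⟨z, hz, le_trans hzy hyx⟩

theorem le_of_add_le_add_left (h₁ : P.padd a b = some x) (h₂ : P.padd a c = some y)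
    (h : P.ps.le x y) : P.ps.le b c := by
  obtain ⟨r, hr⟩ := h
  obtain ⟨z, hz, hz'⟩ := exists_add_assoc h₁ hr
  rw [add_left_cancel h₂ hz']
  exact ⟨r, hz⟩

theorem le_of_add_le_add_right (h₁ : P.padd b a = some x) (h₂ : P.padd c a = some y)
    (h : P.ps.le x y) : P.ps.le b c := by
  obtain ⟨r, hr⟩ := exists_add_of_le h
  obtain ⟨z, hz, hz'⟩ := exists_assoc_add h₁ hr
  rw [add_right_cancel h₂ hz']
  exact le_of_add' hz

section Suprema

variable {I : Type*} {e : I → E} {s : E}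

theorem isSup_unique {S : Set E} {t : E} (hs : P.ps.IsSup S s) (ht : P.ps.IsSup S t) : s = t :=
  le_antisymm (hs.2 t ht.1) (ht.2 s hs.1)

theorem add_isSup_le (hs : P.ps.IsSup (Set.range e) s) (hw : P.padd y s = some w)
    (hy : P.ps.le y u) (he : ∀ i z, P.padd y (e i) = some z → P.ps.le z u) : P.ps.le w u := by
  obtain ⟨v, hv⟩ := hy
  have hsv : P.ps.le s v := hs.2 v <| by
    rintro _ ⟨i, rfl⟩
    obtain ⟨z, hz, -⟩ := exists_add_le_left hw (hs.1 _ ⟨i, rfl⟩)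
    exact le_of_add_le_add_left hz hv (he i z hz)
  obtain ⟨z, hz, hzu⟩ := exists_add_le_left hv hsv
  rwa [Option.some.inj (hw.symm.trans hz)]

theorem isSup_add_le (hs : P.ps.IsSup (Set.range e) s) (hw : P.padd s y = some w)
    (hy : P.ps.le y u) (he : ∀ i z, P.padd (e i) y = some z → P.ps.le z u) : P.ps.le w u := by
  obtain ⟨v, hv⟩ := exists_add_of_le hy
  have hsv : P.ps.le s v := hs.2 v <| by
    rintro _ ⟨i, rfl⟩
    obtain ⟨z, hz, -⟩ := exists_add_le_right hw (hs.1 _ ⟨i, rfl⟩)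
    exact le_of_add_le_add_right hz hv (he i z hz)
  obtain ⟨z, hz, hzu⟩ := exists_add_le_right hv hsv
  rwa [Option.some.inj (hw.symm.trans hz)]

end Suprema

/-- A pair of idempotent additive maps splitting every element: the two coordinate projections of
a direct decomposition of `P`. -/
structure IsSplitting (P : PEA E) (p q : E → E) : Prop where
  map_add_fst : ∀ {a b x}, P.padd a b = some x → P.padd (p a) (p b) = some (p x)
  map_add_snd : ∀ {a b x}, P.padd a b = some x → P.padd (q a) (q b) = some (q x)
  add : ∀ x, P.padd (p x) (q x) = some x
  idem_fst : ∀ x, p (p x) = p x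
  idem_snd : ∀ x, q (q x) = q x

namespace IsSplitting

variable {p q : E → E}

theorem fst_snd (h : P.IsSplitting p q) (x : E) : p (q x) = P.zero :=
  eq_zero_of_add_eq_left (a := p x) (by simpa [h.idem_fst] using h.map_add_fst (h.add x))

theorem snd_fst (h : P.IsSplitting p q) (x : E) : q (p x) = P.zero :=
  eq_zero_of_add_eq_right (b := q x) (by simpa [h.idem_snd] using h.map_add_snd (h.add x))

theorem fst_le (h : P.IsSplitting p q) (x : E) : P.ps.le (p x) x := ⟨_, h.add x⟩

theorem snd_le (h : P.IsSplitting p q) (x : E) : P.ps.le (q x) x := le_of_add' (h.add x)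

theorem fst_mono (h : P.IsSplitting p q) (hxy : P.ps.le x y) : P.ps.le (p x) (p y) := by
  obtain ⟨z, hz⟩ := hxy
  exact ⟨_, h.map_add_fst hz⟩

theorem snd_mono (h : P.IsSplitting p q) (hxy : P.ps.le x y) : P.ps.le (q x) (q y) := by
  obtain ⟨z, hz⟩ := hxy
  exact ⟨_, h.map_add_snd hz⟩

theorem fst_eq_of_snd (h : P.IsSplitting p q) (hx : q x = P.zero) : p x = x :=
  Option.some.inj ((P.padd_zero _).symm.trans (hx ▸ h.add x))

theorem snd_eq_of_fst (h : P.IsSplitting p q) (hx : p x = P.zero) : q x = x :=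
  Option.some.inj ((P.zero_padd _).symm.trans (hx ▸ h.add x))

theorem snd_eq_zero (h : P.IsSplitting p q) (hx : P.ps.le x (p y)) : q x = P.zero :=
  le_zero (h.snd_fst y ▸ h.snd_mono hx)

theorem fst_eq_zero (h : P.IsSplitting p q) (hx : P.ps.le x (q y)) : p x = P.zero :=
  le_zero (h.fst_snd y ▸ h.fst_mono hx)

theorem fst_eq (h : P.IsSplitting p q) (hx : P.ps.le x (p y)) : p x = x :=
  h.fst_eq_of_snd (h.snd_eq_zero hx)

theorem snd_eq (h : P.IsSplitting p q) (hx : P.ps.le x (q y)) : q x = x :=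
  h.snd_eq_of_fst (h.fst_eq_zero hx)

theorem fst_le_one (h : P.IsSplitting p q) (x : E) : P.ps.le (p x) (p P.one) :=
  h.fst_mono (le_one x)

theorem snd_le_one (h : P.IsSplitting p q) (x : E) : P.ps.le (q x) (q P.one) :=
  h.snd_mono (le_one x)

theorem ext (h : P.IsSplitting p q) (h₁ : p x = p y) (h₂ : q x = q y) : x = y :=
  Option.some.inj (((h.add x).symm.trans (by rw [h₁, h₂])).trans (h.add y))

theorem one_add_one (h : P.IsSplitting p q) : P.padd (q P.one) (p P.one) = some P.one := by
  obtain ⟨x, hx, -⟩ := P.exu_left (p P.one)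
  have hp : p x = P.zero := eq_zero_of_add_eq_right (b := p P.one)
    (by simpa [h.idem_fst] using h.map_add_fst hx)
  have hq : q x = q P.one := by
    have := h.map_add_snd hx
    rw [h.snd_fst, P.padd_zero] at this
    exact Option.some.inj this
  rw [h.snd_eq_of_fst hp] at hq
  rwa [← hq]

/-- Elements below complementary central elements have a sum, which does not depend on the order
of the summands. -/
theorem exists_add (h : P.IsSplitting p q) (hx : P.ps.le x (p P.one))
    (hy : P.ps.le y (q P.one)) :
    ∃ w, P.padd x y = some w ∧ P.padd y x = some w ∧ p w = x ∧ q w = y := by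
  obtain ⟨w, hw, -⟩ := exists_add_le (h.add P.one) hx hy
  obtain ⟨w', hw', -⟩ := exists_add_le h.one_add_one hy hx
  have h₁ := h.map_add_fst hw
  have h₂ := h.map_add_snd hw
  have h₃ := h.map_add_fst hw'
  have h₄ := h.map_add_snd hw'
  rw [h.fst_eq hx, h.fst_eq_zero hy, P.padd_zero] at h₁
  rw [h.snd_eq_zero hx, h.snd_eq hy, P.zero_padd] at h₂
  rw [h.fst_eq hx, h.fst_eq_zero hy, P.zero_padd] at h₃
  rw [h.snd_eq_zero hx, h.snd_eq hy, P.padd_zero] at h₄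
  obtain rfl : w = w' :=
    h.ext (Option.some.inj (h₁.symm.trans h₃)) (Option.some.inj (h₂.symm.trans h₄))
  exact ⟨w, hw, hw', (Option.some.inj h₁).symm, (Option.some.inj h₂).symm⟩

theorem add_comm (h : P.IsSplitting p q) (x y : E) : P.padd (p x) (q y) = P.padd (q y) (p x) := by
  obtain ⟨w, hw, hw', -⟩ := h.exists_add (h.fst_le_one x) (h.snd_le_one y)
  rw [hw, hw']

theorem symm (h : P.IsSplitting p q) : P.IsSplitting q p where
  map_add_fst := h.map_add_snd
  map_add_snd := h.map_add_fst
  add x := h.add_comm x x ▸ h.add x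
  idem_fst := h.idem_snd
  idem_snd := h.idem_fst

/-- Coordinatewise sums come from sums. -/
theorem exists_add_of_coord (h : P.IsSplitting p q)
    (h₁ : P.padd (p a) (p b) = some x) (hx : P.ps.le x (p P.one))
    (h₂ : P.padd (q a) (q b) = some y) (hy : P.ps.le y (q P.one)) :
    ∃ w, P.padd a b = some w ∧ p w = x ∧ q w = y := by
  obtain ⟨w, hw, -, hpw, hqw⟩ := h.exists_add hx hy
  obtain ⟨z₁, hz₁, hz₁'⟩ := exists_add_assoc h₁ hw
  obtain ⟨z₂, hz₂, hz₂'⟩ := exists_assoc_add h₂ hz₁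
  rw [h.add_comm] at hz₂
  obtain ⟨z₃, hz₃, hz₃'⟩ := exists_add_assoc hz₂ hz₂'
  obtain ⟨z₄, hz₄, hz₄'⟩ := exists_assoc_add hz₃' hz₁'
  rw [← Option.some.inj ((h.add b).symm.trans hz₃),
    ← Option.some.inj ((h.add a).symm.trans hz₄)] at hz₄'
  exact ⟨w, hz₄', hpw, hqw⟩

theorem isCentral (h : P.IsSplitting p q) : P.ps.IsCentral (p P.one) := by
  refine ⟨q P.one, h.add _, fun x => (p x, q x), fun x => ⟨h.fst_le_one x, h.snd_le_one x⟩,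
    fun x y hxy => h.ext (congrArg Prod.fst hxy) (congrArg Prod.snd hxy), ?_,
    Prod.ext (h.idem_fst _) (h.snd_fst _), rfl, h.add,
    fun a b x hx => ⟨h.map_add_fst hx, h.map_add_snd hx⟩, ?_⟩
  · rintro ⟨y₁, y₂⟩ h₁ h₂
    obtain ⟨w, -, -, hw₁, hw₂⟩ := h.exists_add h₁ h₂
    exact ⟨w, Prod.ext hw₁ hw₂⟩
  · intro a b s t h₁ hs h₂ ht
    obtain ⟨w, hw, -⟩ := h.exists_add_of_coord h₁ hs h₂ ht
    exact ⟨w, hw⟩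

theorem isMeet_fst (h : P.IsSplitting p q) (x : E) : P.ps.IsMeet x (p P.one) (p x) :=
  ⟨h.fst_le x, h.fst_le_one x, fun _ hx hp => h.fst_eq hp ▸ h.fst_mono hx⟩

theorem isMeet_zero (h : P.IsSplitting p q) (hx : P.ps.le x (p P.one))
    (hy : P.ps.le y (q P.one)) : P.ps.IsMeet x y P.zero := by
  refine ⟨P.zero_le _, P.zero_le _, fun z hzx hzy => ?_⟩
  rw [← h.fst_eq (le_trans hzx hx), h.fst_eq_zero (le_trans hzy hy)]
  exact P.zero_le _

theorem fst_comm {p' q' : E → E} (h : P.IsSplitting p q) (k : P.IsSplitting p' q') (x : E) :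
    p (p' x) = p' (p x) := by
  have key : ∀ {p q p' q' : E → E}, P.IsSplitting p q → P.IsSplitting p' q' →
      P.ps.le (p (p' x)) (p' (p x)) := fun h k =>
    (k.isMeet_fst _).2.2 _ (h.fst_mono (k.fst_le x)) (le_trans (h.fst_le _) (k.fst_le_one x))
  exact le_antisymm (key h k) (key k h)

/-- The central elements are closed under meets. -/
theorem exists_inf {p' q' : E → E} (h : P.IsSplitting p q) (h' : P.IsSplitting p' q') :
    ∃ r, P.IsSplitting (fun x => p (p' x)) r := by
  have hr : ∀ x, ∃ w, P.padd (p (q' x)) (q x) = some w ∧ p w = p (q' x) ∧ q w = q x := fun x => by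
    obtain ⟨w, h₁, -, h₂, h₃⟩ := h.exists_add (h.fst_le_one (q' x)) (h.snd_le_one x)
    exact ⟨w, h₁, h₂, h₃⟩
  choose r hr hpr hqr using hr
  refine ⟨r, fun hx => h.map_add_fst (h'.map_add_fst hx), fun {a b x} hx => ?_, fun x => ?_,
    fun x => ?_, fun x => ?_⟩
  · have h₁ := h.map_add_fst (h'.map_add_snd hx)
    have h₂ := h.map_add_snd hx
    rw [← hpr a, ← hpr b] at h₁
    rw [← hqr a, ← hqr b] at h₂
    obtain ⟨w, hw, hpw, hqw⟩ :=
      h.exists_add_of_coord h₁ (h.fst_le_one _) h₂ (h.snd_le_one _)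
    rw [hw, h.ext (hpw.trans (hpr x).symm) (hqw.trans (hqr x).symm)]
  · obtain ⟨z, hz, hz'⟩ := exists_add_assoc (h.map_add_fst (h'.add x)) (h.add x)
    rw [← Option.some.inj ((hr x).symm.trans hz)] at hz'
    exact hz'
  · show p (p' (p (p' x))) = p (p' x)
    rw [← h.fst_comm h', h.idem_fst, h'.idem_fst]
  · refine h.ext ?_ ?_
    · rw [hpr, hpr, h.fst_comm h'.symm, hpr, h.fst_comm h'.symm, h'.idem_snd]
    · rw [hqr, hqr]

end IsSplitting

theorem exists_splitting (hc : P.ps.IsCentral c) : ∃ p q, P.IsSplitting p q ∧ p P.one = c := by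
  obtain ⟨cs, -, f, hle, -, hsurj, -, h1, hadd, hmap, -⟩ := hc
  have key : ∀ y z, P.ps.le y c → P.ps.le z cs → ∀ w, P.padd y z = some w → f w = (y, z) := by
    intro y z hy hz w hw
    obtain ⟨x, hx⟩ := hsurj (y, z) hy hz
    have := hadd x
    rw [hx] at this
    rw [Option.some.inj (hw.symm.trans this), hx]
  refine ⟨fun x => (f x).1, fun x => (f x).2, ⟨fun hx => (hmap _ _ _ hx).1,
    fun hx => (hmap _ _ _ hx).2, hadd, fun x => ?_, fun x => ?_⟩, by simp [h1]⟩
  · simp only [key _ _ (hle x).1 (P.zero_le _) _ (P.padd_zero _)]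
  · simp only [key _ _ (P.zero_le _) (hle x).2 _ (P.zero_padd _)]

/-- In a centrally orthocomplete PEA, pairwise disjoint splittings have a join. -/
theorem exists_splitting_iSup (hco : P.ps.IsCOPEA) {I : Type} {p q : I → E → E}
    (h : ∀ i, P.IsSplitting (p i) (q i))
    (hdisj : ∀ i j, i ≠ j → P.ps.IsMeet (p i P.one) (p j P.one) P.zero) :
    ∃ r t, P.IsSplitting r t ∧ ∀ x, P.ps.IsSup (Set.range fun i => p i x) (r x) := by
  have hsup : ∀ x, ∃ s, P.ps.IsSup (Set.range fun i => p i x) s := fun x =>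
    hco I _ ⟨fun i => p i P.one, fun i => (h i).isCentral, hdisj, fun i => (h i).fst_le_one x⟩
  choose r hr using hsup
  have r_le : ∀ x, P.ps.le (r x) x := fun x => (hr x).2 x <| by
    rintro _ ⟨i, rfl⟩
    exact (h i).fst_le x
  have le_r : ∀ i x, P.ps.le (p i x) (r x) := fun i x => (hr x).1 _ ⟨i, rfl⟩
  choose t ht using r_le
  have p_r : ∀ i x, p i (r x) = p i x := fun i x =>
    le_antisymm ((h i).fst_mono ⟨_, ht x⟩) ((h i).idem_fst x ▸ (h i).fst_mono (le_r i x))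
  have p_t : ∀ i x, p i (t x) = P.zero := fun i x =>
    eq_zero_of_add_eq_left (a := p i x) (by simpa [p_r] using (h i).map_add_fst (ht x))
  have r_idem : ∀ x, r (r x) = r x := fun x => isSup_unique (hr (r x)) (by simpa [p_r] using hr x)
  have t_idem : ∀ x, t (t x) = t x := fun x => by
    have h0 : r (t x) = P.zero := le_zero <| (hr (t x)).2 _ <| by
      rintro _ ⟨i, rfl⟩
      exact p_t i x ▸ P.le_refl _
    have := ht (t x)
    rw [h0, P.zero_padd] at this
    exact Option.some.inj this
  have t_le : ∀ i x, P.ps.le (t x) (q i P.one) := fun i x =>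
    (h i).snd_eq_of_fst (p_t i x) ▸ (h i).snd_le_one _
  have comm_p : ∀ i x y, P.padd (p i x) (t y) = P.padd (t y) (p i x) := fun i x y => by
    obtain ⟨w, hw, hw', -⟩ := (h i).exists_add ((h i).fst_le_one x) (t_le i y)
    rw [hw, hw']
  have comm : ∀ x y w, P.padd (t x) (r y) = some w → P.padd (r y) (t x) = some w := by
    intro x y w hw
    obtain ⟨l, hl, -⟩ := P.exu_left (t x)
    have hrl : P.ps.le (r y) l := (hr y).2 l <| by
      rintro _ ⟨i, rfl⟩
      obtain ⟨z, hz, -⟩ := exists_add_le_left hw (le_r i y)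
      rw [← comm_p] at hz
      exact le_of_add_le_add_right hz hl (le_one z)
    obtain ⟨w', hw', -⟩ := exists_add_le_right hl hrl
    have h₁ : P.ps.le w w' := add_isSup_le (hr y) hw (le_of_add' hw') fun i z hz => by
      obtain ⟨z', hz', hle⟩ := exists_add_le_right hw' (le_r i y)
      rw [comm_p, hz] at hz'
      rwa [Option.some.inj hz']
    have h₂ : P.ps.le w' w := isSup_add_le (hr y) hw' (le_of_add hw) fun i z hz => by
      obtain ⟨z', hz', hle⟩ := exists_add_le_left hw (le_r i y)
      rw [← comm_p, hz] at hz'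
      rwa [Option.some.inj hz']
    rwa [le_antisymm h₁ h₂]
  have r_add : ∀ {a b x y}, P.padd a b = some x → P.padd (r a) (r b) = some y → y = r x := by
    intro a b x y hx hy
    refine isSup_unique ⟨?_, fun u hu => ?_⟩ (hr x)
    · rintro _ ⟨i, rfl⟩
      obtain ⟨z, hz, hzy⟩ := exists_add_le hy (le_r i a) (le_r i b)
      show P.ps.le (p i x) y
      rwa [Option.some.inj (((h i).map_add_fst hx).symm.trans hz)]
    · have hpu : ∀ i, P.ps.le (p i x) u := fun i => hu _ ⟨i, rfl⟩
      have hpa : ∀ i, P.ps.le (p i a) u := fun i =>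
        le_trans (le_of_add ((h i).map_add_fst hx)) (hpu i)
      have hpb : ∀ i, P.ps.le (p i b) u := fun i =>
        le_trans (le_of_add' ((h i).map_add_fst hx)) (hpu i)
      refine isSup_add_le (hr a) hy ((hr b).2 u ?_) fun i z hz =>
        add_isSup_le (hr b) hz (hpa i) fun j v hv => ?_
      · rintro _ ⟨i, rfl⟩
        exact hpb i
      by_cases hij : i = j
      · subst hij
        rw [Option.some.inj (hv.symm.trans ((h i).map_add_fst hx))]
        exact hpu i
      · have hji : P.ps.le (p j b) (q i b) := by
          have h0 : p i (p j b) = P.zero := le_zero <| (hdisj i j hij).2.2 _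
            ((h i).fst_le_one _) (le_trans ((h i).fst_le _) ((h j).fst_le_one b))
          rw [← (h i).snd_eq_of_fst h0]
          exact (h i).snd_mono ((h j).fst_le b)
        have h₁ : P.ps.le (p i a) (p i u) := (h i).idem_fst a ▸ (h i).fst_mono (hpa i)
        have h₂ : P.ps.le (p j b) (q i u) := (h i).snd_eq hji ▸ (h i).snd_mono (hpb j)
        obtain ⟨v', hv', hle⟩ := exists_add_le ((h i).add u) h₁ h₂
        rwa [Option.some.inj (hv.symm.trans hv')]
  have both : ∀ {a b x}, P.padd a b = some x →
      P.padd (r a) (r b) = some (r x) ∧ P.padd (t a) (t b) = some (t x) := by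
    intro a b x hx
    obtain ⟨z₁, hz₁, hz₁'⟩ := exists_add_assoc (ht a) hx
    obtain ⟨z₂, hz₂, hz₂'⟩ := exists_assoc_add (ht b) hz₁
    obtain ⟨z₃, hz₃, hz₃'⟩ := exists_add_assoc (comm _ _ _ hz₂) hz₂'
    obtain ⟨z₄, hz₄, hz₄'⟩ := exists_assoc_add hz₃' hz₁'
    obtain rfl := r_add hx hz₄
    rw [add_left_cancel (ht x) hz₄']
    exact ⟨hz₄, hz₃⟩
  exact ⟨r, t, ⟨fun hx => (both hx).1, fun hx => (both hx).2, ht, r_idem, t_idem⟩, hr⟩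

theorem isCentral_of_isSup (hco : P.ps.IsCOPEA) {I : Type} {d : I → E}
    (hd : ∀ i, P.ps.IsCentral (d i))
    (hdisj : ∀ i j, i ≠ j → P.ps.IsMeet (d i) (d j) P.zero) {s : E}
    (hs : P.ps.IsSup (Set.range d) s) : P.ps.IsCentral s := by
  choose p q h hpd using fun i => exists_splitting (hd i)
  obtain ⟨r, t, hrt, hr⟩ := exists_splitting_iSup hco h (by simpa only [hpd] using hdisj)
  have := hr P.one
  simp only [hpd] at this
  rw [isSup_unique hs this]
  exact hrt.isCentral

/-- In a centrally orthocomplete PEA, every set of central elements has a supremum, and it is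
central. -/
theorem exists_isSup_central (hco : P.ps.IsCOPEA) {S : Set E} (hS : ∀ x ∈ S, P.ps.IsCentral x) :
    ∃ s, P.ps.IsCentral s ∧ P.ps.IsSup S s := by
  let D : E → E → Prop := fun a b => P.ps.IsMeet a b P.zero
  have hD : Std.Symm D := ⟨fun a b hab => ⟨hab.2.1, hab.1, fun z hz hz' => hab.2.2 z hz' hz⟩⟩
  obtain ⟨M, hM⟩ := zorn_subset
    {M : Set E | (∀ m ∈ M, P.ps.IsCentral m ∧ ∃ x ∈ S, P.ps.le m x) ∧ M.Pairwise D} <| by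
      intro C hC hchain
      refine ⟨⋃₀ C, ⟨fun m ⟨N, hN, hm⟩ => (hC hN).1 m hm, ?_⟩,
        fun N hN => Set.subset_sUnion_of_mem hN⟩
      exact (Set.pairwise_sUnion hchain.directedOn).2 fun N hN => (hC hN).2
  have hMD : ∀ i j : M, i ≠ j → P.ps.IsMeet i.1 j.1 P.zero := fun i j hij =>
    hM.prop.2 i.2 j.2 (Subtype.coe_injective.ne hij)
  obtain ⟨s, hs⟩ := hco M Subtype.val
    ⟨Subtype.val, fun i => (hM.prop.1 _ i.2).1, hMD, fun i => P.le_refl _⟩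
  have hsc : P.ps.IsCentral s := isCentral_of_isSup hco (fun i => (hM.prop.1 _ i.2).1) hMD hs
  rw [Subtype.range_val] at hs
  refine ⟨s, hsc, fun x hx => ?_, fun u hu => hs.2 u fun m hm => ?_⟩
  · obtain ⟨p, q, h, rfl⟩ := exists_splitting hsc
    obtain ⟨p', q', h', rfl⟩ := exists_splitting (hS x hx)
    obtain ⟨_, hr⟩ := h.symm.exists_inf h'
    have hqD : ∀ m ∈ M, D (q (p' P.one)) m := fun m hm =>
      hD.symm _ _ (h.isMeet_zero (hs.1 m hm) (h.snd_le_one _))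
    have hmem : q (p' P.one) ∈ M := by
      refine hM.le_of_ge ⟨?_, (Set.pairwise_insert_of_symm).2 ⟨hM.prop.2, fun m hm _ => hqD m hm⟩⟩
        (Set.subset_insert _ _) (Set.mem_insert _ _)
      rintro m (rfl | hm)
      · exact ⟨hr.isCentral, _, hx, h.snd_le _⟩
      · exact hM.prop.1 m hm
    have h0 : q (p' P.one) = P.zero := le_zero ((hqD _ hmem).2.2 _ (P.le_refl _) (P.le_refl _))
    rw [← h.fst_eq_of_snd h0]
    exact h.fst_le_one _
  · obtain ⟨-, x, hx, hmx⟩ := hM.prop.1 m hm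
    exact le_trans hmx (hu x hx)

/-- The center, ordered by the order of `P`. -/
abbrev centerPartialOrder (P : PEA E) : PartialOrder {c : E // P.ps.IsCentral c} where
  le a b := P.ps.le a.1 b.1
  le_refl a := P.le_refl a.1
  le_trans _ _ _ := le_trans
  le_antisymm _ _ h₁ h₂ := Subtype.ext (le_antisymm h₁ h₂)

theorem exists_centerCompleteBooleanAlgebra (hco : P.ps.IsCOPEA) :
    ∃ inst : CompleteBooleanAlgebra {c : E // P.ps.IsCentral c},
      ∀ a b : {c : E // P.ps.IsCentral c}, cbaLe inst a b ↔ P.ps.le a.1 b.1 := by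
  let := centerPartialOrder P
  have hlub : ∀ S : Set {c : E // P.ps.IsCentral c}, ∃ s, IsLUB S s := fun S => by
    obtain ⟨s, hsc, hs⟩ := exists_isSup_central hco (S := Subtype.val '' S) (by
      rintro _ ⟨x, -, rfl⟩
      exact x.2)
    exact ⟨⟨s, hsc⟩, fun x hx => hs.1 _ ⟨x, hx, rfl⟩, fun u hu => hs.2 _ (by
      rintro _ ⟨x, hx, rfl⟩
      exact hu hx)⟩
  choose sup hsup using hlub
  let : SupSet {c : E // P.ps.IsCentral c} := ⟨sup⟩
  let := completeLatticeOfSup {c : E // P.ps.IsCentral c} hsup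
  have hsplit := fun c : {c : E // P.ps.IsCentral c} => exists_splitting c.2
  choose p q h hp using hsplit
  have bot_eq : (⊥ : {c : E // P.ps.IsCentral c}).1 = P.zero := by
    obtain ⟨r, hr⟩ := (h ⊥).exists_inf (h ⊥).symm
    have h0 := hr.isCentral
    simp only [(h ⊥).fst_snd] at h0
    exact le_zero (bot_le (a := (⟨P.zero, h0⟩ : {c : E // P.ps.IsCentral c})))
  refine ⟨completeBooleanAlgebraOfPseudocomplement (fun c => ⟨q c P.one, (h c).symm.isCentral⟩)
    (fun x y => ?_) fun x => ?_, fun a b => Iff.rfl⟩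
  · constructor
    · intro hxy z hzx hzy
      show P.ps.le z.1 _
      rw [bot_eq]
      have hzy' : P.ps.le z.1 (p y P.one) := (hp y).symm ▸ hzy
      exact ((h y).isMeet_zero hzy' hxy).2.2 _ (P.le_refl _) (le_trans hzx (P.le_refl _))
    · intro hxy
      obtain ⟨_, hr⟩ := (h y).exists_inf (h x)
      have hz := hr.isCentral
      have hzx : P.ps.le (p y (p x P.one)) x.1 := hp x ▸ (h y).fst_le _
      have hzy : P.ps.le (p y (p x P.one)) y.1 := hp y ▸ (h y).fst_le_one _
      have h0 := hxy (x := ⟨_, hz⟩) hzx hzy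
      have h0' : p y (p x P.one) = P.zero := le_zero (bot_eq ▸ h0)
      rw [hp] at h0'
      show P.ps.le x.1 (q y P.one)
      rw [← (h y).snd_eq_of_fst h0']
      exact (h y).snd_le_one _
  · apply Subtype.ext
    have h₁ := (h ⟨q x P.one, (h x).symm.isCentral⟩).add P.one
    rw [hp] at h₁
    have h₂ := (h x).one_add_one
    rw [hp] at h₂
    exact add_left_cancel h₁ h₂

theorem exists_isCentralCover (hco : P.ps.IsCOPEA) (e : E) : ∃ d, P.ps.IsCentralCover d e := by
  obtain ⟨s, hsc, hs⟩ := exists_isSup_central hco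
    (S := {x | P.ps.IsCentral x ∧ ∃ d, P.padd d x = some P.one ∧ P.ps.le e d}) fun x hx => hx.1
  obtain ⟨p, q, h, rfl⟩ := exists_splitting hsc
  refine ⟨q P.one, h.symm.isCentral, ?_, fun d hd hed => ?_⟩
  · obtain ⟨e', he', -⟩ := P.exu_right e
    have hse : P.ps.le (p P.one) e' := hs.2 e' <| by
      rintro x ⟨-, d, hdx, hed⟩
      obtain ⟨z, hz, -⟩ := exists_add_le_right hdx hed
      exact le_of_add_le_add_left hz he' (le_one z)
    obtain ⟨z, hz, -⟩ := exists_add_le_left he' hse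
    exact le_of_add_le_add_right hz h.one_add_one (le_one z)
  · obtain ⟨p', q', h', rfl⟩ := exists_splitting hd
    have hle := hs.1 _ ⟨h'.symm.isCentral, _, h'.add P.one, hed⟩
    obtain ⟨z, hz, -⟩ := exists_add_le_left h.one_add_one hle
    exact le_of_add_le_add_right hz (h'.add P.one) (le_one z)

end PEA

end PEApaper

open PEApaper PEApaper.PartialStruct in
/-- Theorem 4.7: in a COPEA:
(1) the supremum of any pairwise disjoint family of central elements is
central, and the center `Γ(E)` is a complete Boolean algebra (under the
induced order);
(2) every `e ∈ E` has a smallest central element above it. -/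
theorem stmt8 {E : Type} (P : PEA E) (hco : P.ps.IsCOPEA) :
    (∀ (I : Type) (c : I → E), (∀ i, P.ps.IsCentral (c i)) →
      (∀ i j, i ≠ j → P.ps.IsMeet (c i) (c j) P.ps.zero) →
      ∀ s, P.ps.IsSup (Set.range c) s → P.ps.IsCentral s) ∧
    (∃ inst : CompleteBooleanAlgebra {c : E // P.ps.IsCentral c},
      ∀ a b : {c : E // P.ps.IsCentral c},
        cbaLe inst a b ↔ P.ps.le a.1 b.1) ∧
    (∀ e : E, ∃ d, P.ps.IsCentralCover d e) := by
  exact ⟨fun _ _ hc hdisj _ hs => PEA.isCentral_of_isSup hco hc hdisj hs,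
    PEA.exists_centerCompleteBooleanAlgebra hco, PEA.exists_isCentralCover hco⟩
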